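/- Let α, β ∈ (0,1), ρ > 0, and T ⊆ ℝ. If player II has a winning strategy in Schmidt's (α,β,ρ) game on ℝ (with the usual metric) with target set T, then player II has a winning strategy τ with the following property: for every rule-following position p of odd length (i.e., ending with a move by I), the one-round response map sending I's last move (x,ρ') to τ's response takes only countably many values, and the preimage of each value is a Borel subset of ℝ × ℝ_{>0}. -/

import Mathlib

open Filter Topology

/-- The history (the list of moves) of the first `n` moves of the run `f`. -/
def histOf {M : Type*} (f : ℕ → M) (n : ℕ) : List M := (List.range n).map f

/-- The axiom of determinacy `AD` for integer games: for every payoff set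
`A ⊆ ℕ^ℕ`, in the game where I plays `x (2k)` and II plays `x (2k+1)`, and I wins
iff `x ∈ A`, one of the players has a winning strategy. -/
def AD : Prop :=
  ∀ A : Set (ℕ → ℕ),
    (∃ σ : List ℕ → ℕ, ∀ x : ℕ → ℕ, (∀ k, x (2 * k) = σ (histOf x (2 * k))) → x ∈ A) ∨
    (∃ τ : List ℕ → ℕ, ∀ x : ℕ → ℕ, (∀ k, x (2 * k + 1) = τ (histOf x (2 * k + 1))) → x ∉ A)

/-- A specification of an infinite two-player game with moves in `M`:
`firstOK` constrains the first move, `moveOK` constrains every single move,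
`stepOK i` constrains consecutive moves (at indices `i`, `i+1`), and `payoffII`
is the winning condition for player II on rule-following runs. -/
structure GameSpec (M : Type*) where
  firstOK : M → Prop
  moveOK : M → Prop
  stepOK : ℕ → M → M → Prop
  payoffII : (ℕ → M) → Prop

namespace GameSpec

variable {M : Type*} (G : GameSpec M)

/-- The first `n` moves of the run `f` follow the rules. -/
def LegalUpTo (f : ℕ → M) (n : ℕ) : Prop :=
  (0 < n → G.firstOK (f 0)) ∧ (∀ i < n, G.moveOK (f i)) ∧
    ∀ i, i + 1 < n → G.stepOK i (f i) (f (i + 1))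

/-- The whole run `f` follows the rules. -/
def Legal (f : ℕ → M) : Prop :=
  G.firstOK (f 0) ∧ (∀ i, G.moveOK (f i)) ∧ ∀ i, G.stepOK i (f i) (f (i + 1))

/-- A finite position (a finite sequence of moves) follows the rules. -/
def ListLegal (p : List M) : Prop :=
  ∃ f : ℕ → M, histOf f p.length = p ∧ G.LegalUpTo f p.length

/-- Player I (who makes the even-indexed moves) follows strategy `σ` in the run `f`. -/
def FollowsI (σ : List M → M) (f : ℕ → M) : Prop :=
  ∀ k, f (2 * k) = σ (histOf f (2 * k))

/-- Player II (who makes the odd-indexed moves) follows strategy `τ` in the run `f`. -/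
def FollowsII (τ : List M → M) (f : ℕ → M) : Prop :=
  ∀ k, f (2 * k + 1) = τ (histOf f (2 * k + 1))

/-- `σ` is a winning strategy for player I: whenever player I follows `σ`, player I
never violates the rules first, and if the whole run follows the rules then the run
is won by player I (i.e. it does not satisfy player II's payoff condition). -/
def WinningI (σ : List M → M) : Prop :=
  ∀ f : ℕ → M, FollowsI σ f →
    (∀ n, G.LegalUpTo f (2 * n) → G.LegalUpTo f (2 * n + 1)) ∧
      (G.Legal f → ¬ G.payoffII f)

/-- `τ` is a winning strategy for player II: whenever player II follows `τ`, player II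
never violates the rules first, and if the whole run follows the rules then the run
satisfies player II's payoff condition. -/
def WinningII (τ : List M → M) : Prop :=
  ∀ f : ℕ → M, FollowsII τ f →
    (∀ n, G.LegalUpTo f (2 * n + 1) → G.LegalUpTo f (2 * n + 2)) ∧
      (G.Legal f → G.payoffII f)

/-- The game is determined: one of the two players has a winning strategy. -/
def Determined : Prop := (∃ σ, G.WinningI σ) ∨ (∃ τ, G.WinningII τ)

end GameSpec

/-- Schmidt's `(α, β)` game on the metric space `X` with target set `T`.
Moves are pairs `(center, radius)`; the first radius must be positive, each ball
must be contained in the previous one (`ρ_{i+1} + d(x_i, x_{i+1}) ≤ ρ_i`), radii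
shrink by `α` after an even-indexed (player I) move and by `β` after an
odd-indexed (player II) move.  Player II wins a rule-following run iff the unique
point of intersection of the balls (the limit of the centers) lies in `T`. -/
def schmidtGame {X : Type*} [MetricSpace X] (α β : ℝ) (T : Set X) :
    GameSpec (X × ℝ) where
  firstOK m := 0 < m.2
  moveOK _ := True
  stepOK i prev next :=
    next.2 + dist prev.1 next.1 ≤ prev.2 ∧ next.2 = (if Even i then α else β) * prev.2
  payoffII f := ∃ z ∈ T, Tendsto (fun n => (f n).1) atTop (𝓝 z)

/-- Schmidt's `(α, β, ρ)` game: like the `(α, β)` game but the first radius must be `ρ`. -/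
def schmidtGameFixed {X : Type*} [MetricSpace X] (α β ρ : ℝ) (T : Set X) :
    GameSpec (X × ℝ) :=
  { schmidtGame α β T with firstOK := fun m => m.2 = ρ }

/-- A set of reals covered by closed intervals of fixed positive radius centred in `W` is already
covered by countably many of them. -/
lemma exists_countable_centers {s : ℝ} (hs : 0 < s) (W A : Set ℝ)
    (h : ∀ x ∈ A, ∃ w ∈ W, dist x w ≤ s) :
    ∃ D ⊆ W, D.Countable ∧ ∀ x ∈ A, ∃ w ∈ D, dist x w ≤ s := by
  obtain ⟨D₀, hD₀W, hD₀, hdense⟩ :=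
    (TopologicalSpace.IsSeparable.of_separableSpace W).exists_countable_dense_subset
  have disj : ∀ E : Set ℝ, (∀ x ∈ E, ∀ x' ∈ E, x < x' → x + s ≤ x') → E.Countable := by
    intro E hE
    refine Set.PairwiseDisjoint.countable_of_Ioo (y := fun x => x + s) ?_
      (fun x _ => by linarith)
    intro x hx x' hx' hne
    refine Set.disjoint_left.2 fun z hz hz' => ?_
    rcases lt_or_gt_of_ne hne with hlt | hlt
    · have := hE x hx x' hx' hlt
      linarith [hz.2, hz'.1]
    · have := hE x' hx' x hx hlt
      linarith [hz.1, hz'.2]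
  let E₁ : Set ℝ := {x | x + s ∈ W ∧ ∀ w ∈ W, s ≤ dist x w}
  let E₂ : Set ℝ := {x | x - s ∈ W ∧ ∀ w ∈ W, s ≤ dist x w}
  have c₁ : E₁.Countable := disj _ fun x hx x' hx' hlt => by
    have := hx'.2 _ hx.1
    rw [Real.dist_eq] at this
    by_contra! hc
    exact absurd (abs_lt.2 ⟨by linarith, by linarith⟩ : |x' - (x + s)| < s) (not_lt.2 this)
  have c₂ : E₂.Countable := disj _ fun x hx x' hx' hlt => by
    have := hx.2 _ hx'.1
    rw [Real.dist_eq] at this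
    by_contra! hc
    exact absurd (abs_lt.2 ⟨by linarith, by linarith⟩ : |x - (x' - s)| < s) (not_lt.2 this)
  refine ⟨D₀ ∪ ((· + s) '' E₁ ∪ (· - s) '' E₂), ?_,
    hD₀.union ((c₁.image _).union (c₂.image _)), ?_⟩
  · rintro w (hw | ⟨x, hx, rfl⟩ | ⟨x, hx, rfl⟩)
    exacts [hD₀W hw, hx.1, hx.1]
  · intro x hx
    by_cases hfar : ∀ w ∈ W, s ≤ dist x w
    · obtain ⟨w, hw, hxw⟩ := h x hx
      have heq : |x - w| = s := le_antisymm hxw (hfar w hw)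
      refine ⟨w, Or.inr ?_, hxw⟩
      rcases (abs_eq hs.le).1 heq with h1 | h1
      · have hw' : x - s = w := by linarith
        exact Or.inr ⟨x, ⟨hw' ▸ hw, hfar⟩, hw'⟩
      · have hw' : x + s = w := by linarith
        exact Or.inl ⟨x, ⟨hw' ▸ hw, hfar⟩, hw'⟩
    · push Not at hfar
      obtain ⟨w, hw, hxw⟩ := hfar
      obtain ⟨b, hb, hwb⟩ := Metric.mem_closure_iff.1 (hdense hw) (s - dist x w) (by linarith)
      exact ⟨b, Or.inl hb, by linarith [dist_triangle x w b]⟩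

/-- `φ` replaces a move in `L` by another move in `L`, the response `t` to which is also a legal
response to the original move, in such a way that only countably many responses occur and
each occurs on a Borel set. -/
lemma exists_simple_substitution {α : ℝ} (hα : α < 1) (L : Set (ℝ × ℝ)) (t : ℝ × ℝ → ℝ × ℝ) :
    ∃ φ : ℝ × ℝ → ℝ × ℝ, (Set.range (t ∘ φ)).Countable ∧
      (∀ y, MeasurableSet {m | t (φ m) = y}) ∧
      ∀ R > 0, (∀ m ∈ L, m.2 = R ∧ (t m).2 + dist m.1 (t m).1 ≤ m.2 ∧ (t m).2 = α * m.2) →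
        ∀ m ∈ L, φ m ∈ L ∧ (t (φ m)).2 + dist m.1 (t (φ m)).1 ≤ m.2 ∧
          (t (φ m)).2 = α * m.2 := by
  classical
  by_cases hyp : L.Nonempty ∧ ∃ R > 0,
      ∀ m ∈ L, m.2 = R ∧ (t m).2 + dist m.1 (t m).1 ≤ m.2 ∧ (t m).2 = α * m.2
  · obtain ⟨⟨m₀, hm₀⟩, R, hR, hL⟩ := hyp
    have hs : 0 < (1 - α) * R := mul_pos (by linarith) hR
    obtain ⟨D, hDW, hDc, hD⟩ := exists_countable_centers hs ((fun m => (t m).1) '' L)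
      (Prod.fst '' L) (by
        rintro _ ⟨m, hm, rfl⟩
        refine ⟨_, ⟨m, hm, rfl⟩, ?_⟩
        obtain ⟨h1, h2, h3⟩ := hL m hm
        rw [h3, h1] at h2
        linarith)
    have hne : D.Nonempty := by
      obtain ⟨w, hw, -⟩ := hD _ ⟨m₀, hm₀, rfl⟩
      exact ⟨w, hw⟩
    obtain ⟨e, he⟩ := hDc.exists_eq_range hne
    have hpre : ∀ k, ∃ m ∈ L, (t m).1 = e k := fun k => hDW (he ▸ ⟨k, rfl⟩)
    choose d hdL hde using hpre
    let P : ℝ × ℝ → ℕ → Prop := fun m k =>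
      dist m.1 (e k) ≤ (1 - α) * R ∨ ∀ j, ¬ dist m.1 (e j) ≤ (1 - α) * R
    have hPex : ∀ m, ∃ k, P m k := by
      intro m
      by_cases hm : ∃ k, dist m.1 (e k) ≤ (1 - α) * R
      · exact ⟨hm.choose, Or.inl hm.choose_spec⟩
      · exact ⟨0, Or.inr (not_exists.1 hm)⟩
    have hbase : ∀ k, MeasurableSet {m : ℝ × ℝ | dist m.1 (e k) ≤ (1 - α) * R} := fun k =>
      measurableSet_le (by fun_prop) measurable_const
    have hnone : MeasurableSet {m : ℝ × ℝ | ∀ j, ¬ dist m.1 (e j) ≤ (1 - α) * R} := by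
      rw [Set.ofPred_forall]
      exact MeasurableSet.iInter fun j => (hbase j).compl
    have hPm : ∀ k, MeasurableSet {m | P m k} := fun k => (hbase k).union hnone
    have hN : Measurable fun m => Nat.find (hPex m) := measurable_find hPex hPm
    refine ⟨fun m => d (Nat.find (hPex m)), ?_, ?_, ?_⟩
    · refine (Set.countable_range (t ∘ d)).mono ?_
      rintro _ ⟨m, rfl⟩
      exact ⟨_, rfl⟩
    · intro y
      exact hN (MeasurableSet.of_discrete (s := {k | t (d k) = y}))
    · intro _ _ _ m hm
      refine ⟨hdL _, ?_⟩
      obtain ⟨h1, -, h3⟩ := hL _ (hdL (Nat.find (hPex m)))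
      have hmR := (hL m hm).1
      have hclose : dist m.1 (e (Nat.find (hPex m))) ≤ (1 - α) * R := by
        rcases Nat.find_spec (hPex m) with h | h
        · exact h
        · obtain ⟨w, hw, hmw⟩ := hD _ ⟨m, hm, rfl⟩
          rw [he] at hw
          obtain ⟨k, rfl⟩ := hw
          exact absurd hmw (h k)
      refine ⟨?_, by rw [h3, h1, hmR]⟩
      rw [hde, h3, h1, hmR]
      linarith
  · refine ⟨fun _ => 0, ?_, fun y => MeasurableSet.const _, ?_⟩
    · exact (Set.countable_singleton (t 0)).mono (by rintro _ ⟨m, rfl⟩; rfl)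
    · intro R hR hL m hm
      exact absurd ⟨⟨m, hm⟩, R, hR, hL⟩ hyp

section Runs

variable {M : Type*}

lemma histOf_succ (f : ℕ → M) (n : ℕ) : histOf f (n + 1) = histOf f n ++ [f n] := by
  simp [histOf, List.range_succ]

lemma length_histOf (f : ℕ → M) (n : ℕ) : (histOf f n).length = n := by
  simp [histOf]

lemma histOf_congr {f g : ℕ → M} {n : ℕ} (h : ∀ i < n, f i = g i) : histOf f n = histOf g n :=
  List.map_congr_left fun i hi => h i (List.mem_range.1 hi)

/-- Every rule prescribing the next move from the history is realised by a run. -/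
lemma exists_run (σ : List M → M) : ∃ f : ℕ → M, ∀ n, f n = σ (histOf f n) := by
  let H : ℕ → List M := fun n => Nat.rec [] (fun _ l => l ++ [σ l]) n
  have hH : ∀ n, histOf (fun n => σ (H n)) n = H n := by
    intro n
    induction n with
    | zero => rfl
    | succ n ih => rw [histOf_succ, ih]
  exact ⟨fun n => σ (H n), fun n => by rw [hH]⟩

/-- Player I may deviate to `m` at any turn of a run in which player II follows `τ`. -/
lemma exists_deviation {τ : List M → M} {g : ℕ → M} (hg : GameSpec.FollowsII τ g) (n : ℕ)
    (m : M) :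
    ∃ g' : ℕ → M, GameSpec.FollowsII τ g' ∧ (∀ i < 2 * n, g' i = g i) ∧ g' (2 * n) = m := by
  obtain ⟨f, hf⟩ := exists_run fun h : List M =>
    if h.length < 2 * n then g h.length else if h.length = 2 * n then m else τ h
  simp only [length_histOf] at hf
  have hlt : ∀ i < 2 * n, f i = g i := fun i hi => by rw [hf i, if_pos hi]
  refine ⟨f, fun k => ?_, hlt, ?_⟩
  · by_cases hk : 2 * k + 1 < 2 * n
    · rw [hlt _ hk, hg k]
      exact congrArg τ (histOf_congr fun i hi => (hlt i (by omega)).symm)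
    · rw [hf, if_neg hk, if_neg (by omega)]
  · rw [hf, if_neg (lt_irrefl _), if_pos rfl]

/-- The history in which player I's moves are replaced according to `φ` and player II answers the
replaced moves by `τ`. -/
def simulate (τ : List M → M) (φ : List M → M → M) (h : List M) : List M :=
  h.foldl (fun q m => q ++ [if Even q.length then φ q m else τ q]) []

variable (τ : List M → M) (φ : List M → M → M)

lemma simulate_concat (h : List M) (m : M) :
    simulate τ φ (h ++ [m]) = simulate τ φ h ++
      [if Even (simulate τ φ h).length then φ (simulate τ φ h) m else τ (simulate τ φ h)] := by
  rw [simulate, List.foldl_append]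
  rfl

lemma length_simulate (h : List M) : (simulate τ φ h).length = h.length := by
  induction h using List.reverseRecOn with
  | nil => rfl
  | append_singleton l a ih => rw [simulate_concat]; simp [ih]

lemma simulate_concat_of_even {h : List M} (hh : Even h.length) (m : M) :
    simulate τ φ (h ++ [m]) = simulate τ φ h ++ [φ (simulate τ φ h) m] := by
  rw [simulate_concat, length_simulate, if_pos hh]

variable {τ φ}

/-- A run against the simulated strategy shadows a run against `τ` with the same moves of
player II. -/
lemma exists_shadow {f : ℕ → M} (hf : GameSpec.FollowsII (fun h => τ (simulate τ φ h)) f) :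
    ∃ g : ℕ → M, GameSpec.FollowsII τ g ∧ (∀ k, g (2 * k + 1) = f (2 * k + 1)) ∧
      ∀ k, g (2 * k) = φ (histOf g (2 * k)) (f (2 * k)) := by
  let S : ℕ → List M := fun n => simulate τ φ (histOf f n)
  let g : ℕ → M := fun n => if Even n then φ (S n) (f n) else τ (S n)
  have hS : ∀ n, histOf g n = S n := by
    intro n
    induction n with
    | zero => rfl
    | succ n ih =>
      rw [histOf_succ, ih]
      simp only [S, g, histOf_succ, simulate_concat, length_simulate, length_histOf]
  have hodd : ∀ k, g (2 * k + 1) = τ (S (2 * k + 1)) := fun k =>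
    if_neg (by simp)
  refine ⟨g, fun k => by rw [hS, hodd], fun k => by rw [hodd, hf k], fun k => ?_⟩
  rw [hS]
  exact if_pos (by simp)

end Runs

section Schmidt

variable {X : Type*} [MetricSpace X] {α β ρ : ℝ} {T : Set X} {f : ℕ → X × ℝ}

lemma legalUpTo_schmidtGameFixed_succ {n : ℕ} :
    (schmidtGameFixed α β ρ T).LegalUpTo f (n + 2) ↔
      (schmidtGameFixed α β ρ T).LegalUpTo f (n + 1) ∧
        (f (n + 1)).2 + dist (f n).1 (f (n + 1)).1 ≤ (f n).2 ∧
        (f (n + 1)).2 = (if Even n then α else β) * (f n).2 := by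
  constructor
  · rintro ⟨h1, -, h3⟩
    exact ⟨⟨fun _ => h1 (by omega), fun _ _ => trivial, fun i hi => h3 i (by omega)⟩,
      h3 n (by omega)⟩
  · rintro ⟨⟨h1, -, h3⟩, h4⟩
    refine ⟨fun _ => h1 (by omega), fun _ _ => trivial, fun i hi => ?_⟩
    rcases Nat.lt_succ_iff_lt_or_eq.1 (show i < n + 1 by omega) with h | rfl
    · exact h3 i (by omega)
    · exact h4

lemma GameSpec.Legal.legalUpTo {M : Type*} {G : GameSpec M} {f : ℕ → M} (h : G.Legal f) (n : ℕ) :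
    G.LegalUpTo f n :=
  ⟨fun _ => h.1, fun i _ => h.2.1 i, fun i _ => h.2.2 i⟩

lemma GameSpec.legal_of_forall_legalUpTo {M : Type*} {G : GameSpec M} {f : ℕ → M}
    (h : ∀ n, G.LegalUpTo f n) : G.Legal f :=
  ⟨(h 1).1 one_pos, fun i => (h (i + 1)).2.1 i (by omega),
    fun i => (h (i + 2)).2.2 i (by omega)⟩

lemma radius_pos (hα : 0 < α) (hβ : 0 < β) (hρ : 0 < ρ) {n : ℕ}
    (h : (schmidtGameFixed α β ρ T).LegalUpTo f (n + 1)) : 0 < (f n).2 := by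
  induction n with
  | zero =>
    have h0 : (f 0).2 = ρ := h.1 one_pos
    rwa [h0]
  | succ n ih =>
    obtain ⟨h1, -, h3⟩ := legalUpTo_schmidtGameFixed_succ.1 h
    rw [h3]
    have := ih h1
    split_ifs <;> positivity

lemma tendsto_radius (hα : α ∈ Set.Ioo (0 : ℝ) 1) (hβ : β ∈ Set.Ioo (0 : ℝ) 1) (hρ : 0 < ρ)
    (h : (schmidtGameFixed α β ρ T).Legal f) : Tendsto (fun n => (f n).2) atTop (𝓝 0) := by
  have hpos : ∀ n, 0 < (f n).2 := fun n => radius_pos hα.1 hβ.1 hρ (h.legalUpTo (n + 1))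
  have hle : ∀ n, (f n).2 ≤ max α β ^ n * (f 0).2 := by
    intro n
    induction n with
    | zero => simp
    | succ n ih =>
      have hstep := (legalUpTo_schmidtGameFixed_succ.1 (h.legalUpTo (n + 2))).2.2
      have hc : (if Even n then α else β) ≤ max α β := by
        split_ifs
        exacts [le_max_left _ _, le_max_right _ _]
      calc (f (n + 1)).2 ≤ max α β * (f n).2 := by
            rw [hstep]; exact mul_le_mul_of_nonneg_right hc (hpos n).le
        _ ≤ max α β * (max α β ^ n * (f 0).2) :=
            mul_le_mul_of_nonneg_left ih (le_max_of_le_left hα.1.le)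
        _ = max α β ^ (n + 1) * (f 0).2 := by ring
  have hlim : Tendsto (fun n => max α β ^ n * (f 0).2) atTop (𝓝 0) := by
    simpa using (tendsto_pow_atTop_nhds_zero_of_lt_one (le_max_of_le_left hα.1.le)
      (max_lt hα.2 hβ.2)).mul_const (f 0).2
  exact squeeze_zero (fun n => (hpos n).le) hle hlim

/-- If two rule-following runs agree on player II's moves, they have the same outcome. -/
lemma payoffII_of_agree (hα : α ∈ Set.Ioo (0 : ℝ) 1) (hβ : β ∈ Set.Ioo (0 : ℝ) 1) (hρ : 0 < ρ)
    {g : ℕ → X × ℝ} (hf : (schmidtGameFixed α β ρ T).Legal f)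
    (hg : (schmidtGameFixed α β ρ T).Legal g) (hfg : ∀ k, g (2 * k + 1) = f (2 * k + 1))
    (h : (schmidtGameFixed α β ρ T).payoffII g) : (schmidtGameFixed α β ρ T).payoffII f := by
  obtain ⟨z, hz, hlim⟩ := h
  refine ⟨z, hz, hlim.congr_dist ?_⟩
  have hfpos : ∀ n, 0 < (f n).2 := fun n => radius_pos hα.1 hβ.1 hρ (hf.legalUpTo (n + 1))
  have hgpos : ∀ n, 0 < (g n).2 := fun n => radius_pos hα.1 hβ.1 hρ (hg.legalUpTo (n + 1))
  refine squeeze_zero (fun _ => dist_nonneg) (g := fun n => (g n).2 + (f n).2) (fun n => ?_)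
    (by simpa using (tendsto_radius hα hβ hρ hg).add (tendsto_radius hα hβ hρ hf))
  rcases Nat.even_or_odd' n with ⟨k, rfl | rfl⟩
  · have h1 := (legalUpTo_schmidtGameFixed_succ.1 (hf.legalUpTo (2 * k + 2))).2.1
    have h2 := (legalUpTo_schmidtGameFixed_succ.1 (hg.legalUpTo (2 * k + 2))).2.1
    have h3 := dist_triangle_right (g (2 * k)).1 (f (2 * k)).1 (f (2 * k + 1)).1
    rw [hfg] at h2
    linarith [hfpos (2 * k + 1)]
  · rw [hfg, dist_self]
    linarith [hfpos (2 * k + 1)]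

/-- The moves that player I may legally make after the position `q` of even length. -/
def legalMovesI (X : Type*) [MetricSpace X] (β ρ : ℝ) (q : List (X × ℝ)) : Set (X × ℝ) :=
  {m | (q = [] → m.2 = ρ) ∧
    ∀ a, q.getLast? = some a → m.2 + dist a.1 m.1 ≤ a.2 ∧ m.2 = β * a.2}

lemma legalUpTo_odd_iff {n : ℕ} :
    (schmidtGameFixed α β ρ T).LegalUpTo f (2 * n + 1) ↔
      (schmidtGameFixed α β ρ T).LegalUpTo f (2 * n) ∧
        f (2 * n) ∈ legalMovesI X β ρ (histOf f (2 * n)) := by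
  cases n with
  | zero =>
    constructor
    · intro h
      refine ⟨⟨fun h0 => absurd h0 (by simp), fun _ _ => trivial, fun i hi => by omega⟩,
        fun _ => h.1 one_pos, fun a ha => ?_⟩
      simp [histOf] at ha
    · rintro ⟨-, h⟩
      exact ⟨fun _ => h.1 rfl, fun _ _ => trivial, fun i hi => by omega⟩
  | succ k =>
    have hodd : ¬ Even (2 * k + 1) := by simp
    rw [show 2 * (k + 1) + 1 = (2 * k + 1) + 2 by ring, legalUpTo_schmidtGameFixed_succ,
      show 2 * (k + 1) = 2 * k + 1 + 1 by ring, histOf_succ, if_neg hodd]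
    simp [legalMovesI]

lemma radius_eq_of_mem_legalMovesI (hα : 0 < α) (hβ : 0 < β) (hρ : 0 < ρ) {n : ℕ}
    (h : (schmidtGameFixed α β ρ T).LegalUpTo f (2 * n)) :
    ∃ R > 0, ∀ m ∈ legalMovesI X β ρ (histOf f (2 * n)), m.2 = R := by
  cases n with
  | zero => exact ⟨ρ, hρ, fun m hm => hm.1 rfl⟩
  | succ k =>
    refine ⟨β * (f (2 * k + 1)).2, mul_pos hβ (radius_pos hα hβ hρ h), fun m hm => ?_⟩
    refine (hm.2 _ ?_).2
    rw [show 2 * (k + 1) = 2 * k + 1 + 1 by ring, histOf_succ]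
    simp

/-- A winning strategy of player II answers every legal move of player I legally. -/
lemma response_legal {τ : List (X × ℝ) → X × ℝ} (hτ : (schmidtGameFixed α β ρ T).WinningII τ)
    {g : ℕ → X × ℝ} (hg : GameSpec.FollowsII τ g) {n : ℕ}
    (hleg : (schmidtGameFixed α β ρ T).LegalUpTo g (2 * n)) {m : X × ℝ}
    (hm : m ∈ legalMovesI X β ρ (histOf g (2 * n))) :
    (τ (histOf g (2 * n) ++ [m])).2 + dist m.1 (τ (histOf g (2 * n) ++ [m])).1 ≤ m.2 ∧
      (τ (histOf g (2 * n) ++ [m])).2 = α * m.2 := by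
  obtain ⟨g', hg', heq, rfl⟩ := exists_deviation hg n m
  have hhist : histOf g' (2 * n) = histOf g (2 * n) := histOf_congr heq
  have hleg' : (schmidtGameFixed α β ρ T).LegalUpTo g' (2 * n) := by
    refine ⟨fun h0 => ?_, fun _ _ => trivial, fun i hi => ?_⟩
    · rw [heq 0 h0]; exact hleg.1 h0
    · rw [heq i (by omega), heq (i + 1) hi]; exact hleg.2.2 i hi
  have h := (legalUpTo_schmidtGameFixed_succ.1
    ((hτ g' hg').1 n (legalUpTo_odd_iff.2 ⟨hleg', hhist ▸ hm⟩))).2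
  rwa [if_pos (by simp), hg' n, histOf_succ, hhist] at h

end Schmidt

/-- If player II has a winning strategy in Schmidt's `(α, β, ρ)` game on `ℝ` with
target set `T`, then player II has a winning strategy `τ` which is *simple*: for
every rule-following position `p` of odd length (ending with a move of player I),
the one-round response map sending player I's last move `(x, ρ')` (with `ρ' > 0`)
to `τ`'s response takes only countably many values, and the preimage of each value
is a Borel subset of `ℝ × ℝ_{>0}`. -/
theorem playerII_has_simple_winning_strategy_real
    (α β ρ : ℝ) (hα : α ∈ Set.Ioo (0 : ℝ) 1) (hβ : β ∈ Set.Ioo (0 : ℝ) 1)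
    (hρ : 0 < ρ) (T : Set ℝ)
    (h : ∃ τ, (schmidtGameFixed α β ρ T).WinningII τ) :
    ∃ τ, (schmidtGameFixed α β ρ T).WinningII τ ∧
      ∀ p : List (ℝ × ℝ), Odd p.length → (schmidtGameFixed α β ρ T).ListLegal p →
        Set.Countable ((fun m : ℝ × ℝ => τ (p.dropLast ++ [m])) '' {m : ℝ × ℝ | 0 < m.2}) ∧
        ∀ y : ℝ × ℝ, MeasurableSet {m : ℝ × ℝ | 0 < m.2 ∧ τ (p.dropLast ++ [m]) = y} := by
  obtain ⟨τ, hτ⟩ := h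
  choose φ hcount hmeas hφ using fun q : List (ℝ × ℝ) =>
    exists_simple_substitution hα.2 (legalMovesI ℝ β ρ q) fun m => τ (q ++ [m])
  refine ⟨fun h => τ (simulate τ φ h), fun f hf => ?_, fun p hp _ => ?_⟩
  · obtain ⟨g, hg, hodd, heven⟩ := exists_shadow hf
    have key : ∀ n, (schmidtGameFixed α β ρ T).LegalUpTo f (2 * n + 1) →
        (schmidtGameFixed α β ρ T).LegalUpTo g (2 * n) →
        (schmidtGameFixed α β ρ T).LegalUpTo g (2 * n + 2) ∧
          (schmidtGameFixed α β ρ T).LegalUpTo f (2 * n + 2) := by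
      intro n hfn hgn
      have hfm : f (2 * n) ∈ legalMovesI ℝ β ρ (histOf g (2 * n)) := by
        have := (legalUpTo_odd_iff.1 hfn).2
        cases n with
        | zero => exact this
        | succ k =>
          rw [show 2 * (k + 1) = 2 * k + 1 + 1 by ring, histOf_succ] at this ⊢
          simpa [legalMovesI, hodd k] using this
      obtain ⟨R, hR, hrad⟩ := radius_eq_of_mem_legalMovesI hα.1 hβ.1 hρ hgn
      obtain ⟨hmem, hresp⟩ := hφ _ R hR
        (fun m hm => ⟨hrad m hm, response_legal hτ hg hgn hm⟩) _ hfm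
      rw [← heven] at hmem
      simp only [← heven, ← histOf_succ, ← hg n, hodd n] at hresp
      refine ⟨(hτ g hg).1 n (legalUpTo_odd_iff.2 ⟨hgn, hmem⟩),
        legalUpTo_schmidtGameFixed_succ.2 ⟨hfn, ?_⟩⟩
      rwa [if_pos (by simp)]
    have hshadow : ∀ n, (schmidtGameFixed α β ρ T).LegalUpTo f (2 * n + 1) →
        (schmidtGameFixed α β ρ T).LegalUpTo g (2 * n) := by
      intro n
      induction n with
      | zero =>
        exact fun _ => ⟨fun h0 => absurd h0 (by simp), fun _ _ => trivial, fun i hi => by omega⟩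
      | succ k ih =>
        intro hf'
        have hf'' : (schmidtGameFixed α β ρ T).LegalUpTo f (2 * k + 1) :=
          (legalUpTo_schmidtGameFixed_succ.1 (legalUpTo_odd_iff.1 hf').1).1
        exact (key k hf'' (ih hf'')).1
    refine ⟨fun n hn => (key n hn (hshadow n hn)).2, fun hleg => ?_⟩
    have hgleg : (schmidtGameFixed α β ρ T).Legal g := by
      refine GameSpec.legal_of_forall_legalUpTo fun n => ?_
      have h := hshadow (n + 1) (hleg.legalUpTo _)
      exact ⟨fun _ => h.1 (by omega), fun _ _ => trivial, fun i hi => h.2.2 i (by omega)⟩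
    exact payoffII_of_agree hα hβ hρ hleg hgleg hodd ((hτ g hg).2 hgleg)
  · have hlen : Even p.dropLast.length := by
      rw [List.length_dropLast]
      obtain ⟨k, hk⟩ := hp
      exact ⟨k, by omega⟩
    simp only [simulate_concat_of_even τ φ hlen]
    refine ⟨(hcount (simulate τ φ p.dropLast)).mono ?_, fun y => ?_⟩
    · rintro _ ⟨m, -, rfl⟩
      exact ⟨m, rfl⟩
    · exact (measurableSet_lt measurable_const measurable_snd).inter
        (hmeas (simulate τ φ p.dropLast) y)
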